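/- arXiv:1903.01101 — 2 statements merged into one kernel-verified Lean document; each statement's English description precedes it below -/
import Mathlib

section
/- Suppose C^∞ ∩ A⁻¹(D^∞) = {0} and that F is a KL function with exponent θ ∈ [0, 1). Let 0 < L_min ≤ L_max < ∞ and c > 0, let x⁰ ∈ C, and let {x^t} ⊆ C be a sequence such that for every t ≥ 0 there exist η^t ∈ Proj_D(Ax^t) and L̄_t ∈ [L_min, L_max] with x^{t+1} ∈ Proj_C(x^t − Aᵀ(Ax^t − η^t)/L̄_t) and d(Ax^{t+1}, D)² ≤ d(Ax^t, D)² − c‖x^{t+1} − x^t‖² (the iterates of SpFeas_DC_ls with M = 0). Let x* be an accumulation point of {x^t} such that y ↦ ½ d(y, D)² is continuously differentiable on a neighborhood of Ax* with locally Lipschitz gradient there. Then: (i) if θ = 0, there exists t̄ ≥ 0 such that x^t = x* for all t ≥ t̄; (ii) if θ ∈ (0, ½], there exist t̄ ≥ 0, d̄ > 0 and σ ∈ (0, 1) such that ‖x^t − x*‖ ≤ d̄·σ^t for all t ≥ t̄; (iii) if θ ∈ (½, 1), there exist t̄ ≥ 0 and d̄ > 0 such that ‖x^t − x*‖ ≤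 d̄·t^{−(1−θ)/(2θ−1)} for all t ≥ t̄. -/
open Filter Topology Metric
open scoped RealInnerProductSpace

noncomputable section

/-- The set of projections of `y` onto `S`. -/
def projSet {E : Type*} [NormedAddCommGroup E] (S : Set E) (y : E) : Set E :=
  {z | z ∈ S ∧ dist y z = Metric.infDist y S}

/-- The horizon cone of `S`. -/
def horizonCone {E : Type*} [NormedAddCommGroup E] [NormedSpace ℝ E] (S : Set E) : Set E :=
  {x | ∃ (u : ℕ → E) (β : ℕ → ℝ), (∀ t, u t ∈ S) ∧ (∀ t, 0 < β t) ∧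
    Tendsto β atTop (𝓝 (0 : ℝ)) ∧ Tendsto (fun t => β t • u t) atTop (𝓝 x)}

/-- The regular (Fréchet) normal cone to `S` at `x`. -/
def regNormalCone {E : Type*} [NormedAddCommGroup E] [InnerProductSpace ℝ E]
    (S : Set E) (x : E) : Set E :=
  {v | x ∈ S ∧ ∀ ε > 0, ∃ δ > 0, ∀ u ∈ S, ‖u - x‖ < δ → ⟪v, u - x⟫ ≤ ε * ‖u - x‖}

/-- The limiting normal cone to `S` at `x`. -/
def normalCone {E : Type*} [NormedAddCommGroup E] [InnerProductSpace ℝ E]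
    (S : Set E) (x : E) : Set E :=
  {v | x ∈ S ∧ ∃ (xs vs : ℕ → E), (∀ t, vs t ∈ regNormalCone S (xs t)) ∧
    Tendsto xs atTop (𝓝 x) ∧ Tendsto vs atTop (𝓝 v)}

/-- The regular (Fréchet) subdifferential at `x` of the function `φ + δ_C`
(the real-valued function `φ` plus the indicator of `C`). -/
def regSubdiff {E : Type*} [NormedAddCommGroup E] [InnerProductSpace ℝ E]
    (φ : E → ℝ) (C : Set E) (x : E) : Set E :=
  {v | x ∈ C ∧ ∀ ε > 0, ∃ δ > 0, ∀ u ∈ C, ‖u - x‖ < δ →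
      φ u - φ x - ⟪v, u - x⟫ ≥ -(ε * ‖u - x‖)}

/-- The limiting subdifferential at `x` of the function `φ + δ_C`. -/
def limSubdiff {E : Type*} [NormedAddCommGroup E] [InnerProductSpace ℝ E]
    (φ : E → ℝ) (C : Set E) (x : E) : Set E :=
  {v | x ∈ C ∧ ∃ (xs vs : ℕ → E), (∀ t, vs t ∈ regSubdiff φ C (xs t)) ∧
    Tendsto xs atTop (𝓝 x) ∧ Tendsto (fun t => φ (xs t)) atTop (𝓝 (φ x)) ∧
    Tendsto vs atTop (𝓝 v)}

/-- The smooth part `x ↦ ½ d(Ax, D)²` of the split-feasibility objective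
`F = ½ d(A·, D)² + δ_C`. -/
def phiF {n m : ℕ} (A : EuclideanSpace ℝ (Fin n) →L[ℝ] EuclideanSpace ℝ (Fin m))
    (D : Set (EuclideanSpace ℝ (Fin m))) (x : EuclideanSpace ℝ (Fin n)) : ℝ :=
  Metric.infDist (A x) D ^ 2 / 2

/-- A polyhedral set: an intersection of finitely many closed half-spaces. -/
def IsPolyhedral {E : Type*} [NormedAddCommGroup E] [InnerProductSpace ℝ E] (S : Set E) : Prop :=
  ∃ (k : ℕ) (a : Fin k → E) (b : Fin k → ℝ), S = {x | ∀ i, ⟪a i, x⟫ ≤ b i}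

end

section Subdifferential

variable {E : Type*} [NormedAddCommGroup E] [InnerProductSpace ℝ E]

theorem HasGradientAt.eq_sub_of_mem_projSet [CompleteSpace E] {D : Set E} {y η g : E}
    (hη : η ∈ projSet D y) (hg : HasGradientAt (fun z => infDist z D ^ 2 / 2) g y) :
    g = y - η := by
  have hsq : HasFDerivAt (fun z : E => ‖z - η‖ ^ 2 / 2) (innerSL ℝ (y - η)) y := by
    have h := (((hasFDerivAt_id (𝕜 := ℝ) y).sub_const η).norm_sq).const_mul (1 / 2 : ℝ)
    have hfun : (fun z : E => ‖z - η‖ ^ 2 / 2) = fun z => 1 / 2 * ‖id z - η‖ ^ 2 := by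
      funext z
      simp only [id]
      ring
    rw [hfun]
    exact h.congr_fderiv (by ext v; simp)
  have hdiff := hsq.sub hg.hasFDerivAt
  have hmin : IsLocalMin ((fun z : E => ‖z - η‖ ^ 2 / 2) - fun z => infDist z D ^ 2 / 2) y := by
    refine Filter.Eventually.of_forall fun z => ?_
    have h1 : infDist z D ≤ ‖z - η‖ := by
      simpa [dist_eq_norm] using infDist_le_dist_of_mem (x := z) hη.1
    have h2 : ‖y - η‖ = infDist y D := by simpa [dist_eq_norm] using hη.2
    have h3 : (0 : ℝ) ≤ infDist z D := infDist_nonneg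
    simp only [Pi.sub_apply, h2]
    nlinarith
  have hzero := hmin.hasFDerivAt_eq_zero hdiff
  refine (ext_inner_right ℝ fun v => ?_).symm
  have h := DFunLike.congr_fun hzero v
  simpa [sub_eq_zero, inner_sub_left] using h

theorem mem_regNormalCone_of_mem_projSet {S : Set E} {y z : E} (hz : z ∈ projSet S y) :
    y - z ∈ regNormalCone S z := by
  refine ⟨hz.1, fun ε hε => ⟨ε, hε, fun u hu hlt => ?_⟩⟩
  have h1 : ‖y - z‖ ≤ ‖y - u‖ := by
    rw [← dist_eq_norm, ← dist_eq_norm, hz.2]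
    exact infDist_le_dist_of_mem hu
  have h2 : ‖y - u‖ ^ 2 = ‖y - z‖ ^ 2 - 2 * ⟪y - z, u - z⟫ + ‖u - z‖ ^ 2 := by
    rw [← norm_sub_sq_real]
    congr 2
    abel
  have h3 := norm_nonneg (y - z)
  have h4 := norm_nonneg (u - z)
  nlinarith

theorem smul_mem_regNormalCone {S : Set E} {x v : E} {L : ℝ} (hL : 0 < L)
    (hv : v ∈ regNormalCone S x) : L • v ∈ regNormalCone S x := by
  refine ⟨hv.1, fun ε hε => ?_⟩
  obtain ⟨δ, hδ, h⟩ := hv.2 (ε / L) (by positivity)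
  refine ⟨δ, hδ, fun u hu hlt => ?_⟩
  rw [real_inner_smul_left]
  calc L * ⟪v, u - x⟫ ≤ L * (ε / L * ‖u - x‖) := by gcongr; exact h u hu hlt
    _ = ε * ‖u - x‖ := by field_simp

theorem add_mem_regSubdiff [CompleteSpace E] {φ : E → ℝ} {S : Set E} {x v g : E}
    (hg : HasGradientAt φ g x) (hv : v ∈ regNormalCone S x) : v + g ∈ regSubdiff φ S x := by
  refine ⟨hv.1, fun ε hε => ?_⟩
  obtain ⟨δ₁, hδ₁, h₁⟩ := hv.2 (ε / 2) (by positivity)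
  have h := (hasGradientAt_iff_isLittleO.1 hg).def (half_pos hε)
  obtain ⟨δ₂, hδ₂, h₂⟩ := Metric.eventually_nhds_iff.1 h
  refine ⟨min δ₁ δ₂, lt_min hδ₁ hδ₂, fun u hu hlt => ?_⟩
  have h3 := h₁ u hu (hlt.trans_le (min_le_left _ _))
  have h4 := h₂ (y := u) (by rw [dist_eq_norm]; exact hlt.trans_le (min_le_right _ _))
  rw [Real.norm_eq_abs, abs_le] at h4
  rw [inner_add_left]
  linarith [h4.1]

theorem regSubdiff_subset_limSubdiff {φ : E → ℝ} {S : Set E} {x : E} :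
    regSubdiff φ S x ⊆ limSubdiff φ S x := fun v hv =>
  ⟨hv.1, fun _ => x, fun _ => v, fun _ => hv, tendsto_const_nhds, tendsto_const_nhds,
    tendsto_const_nhds⟩

end Subdifferential

section PhiF

variable {n m : ℕ} {A : EuclideanSpace ℝ (Fin n) →L[ℝ] EuclideanSpace ℝ (Fin m)}
  {C : Set (EuclideanSpace ℝ (Fin n))} {D : Set (EuclideanSpace ℝ (Fin m))}

theorem continuous_phiF : Continuous (phiF A D) := by
  unfold phiF
  exact (((continuous_infDist_pt D).comp A.continuous).pow 2).div_const 2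

theorem hasGradientAt_phiF {z : EuclideanSpace ℝ (Fin n)} {g : EuclideanSpace ℝ (Fin m)}
    (hg : HasGradientAt (fun y => infDist y D ^ 2 / 2) g (A z)) :
    HasGradientAt (phiF A D) (ContinuousLinearMap.adjoint A g) z := by
  rw [hasGradientAt_iff_hasFDerivAt] at hg ⊢
  exact (hg.comp z A.hasFDerivAt).congr_fderiv
    (by ext v; simp [ContinuousLinearMap.adjoint_inner_left])

/-- One projected-gradient step yields a subgradient at the new point bounded by the step. -/
theorem exists_mem_regSubdiff_norm_le {Lmax : ℝ} {U : Set (EuclideanSpace ℝ (Fin m))}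
    {g : EuclideanSpace ℝ (Fin m) → EuclideanSpace ℝ (Fin m)} {K : NNReal}
    (hg : ∀ y ∈ U, HasGradientAt (fun z => infDist z D ^ 2 / 2) (g y) y)
    (hK : LipschitzOnWith K g U) {z z' : EuclideanSpace ℝ (Fin n)} (hz : A z ∈ U) (hz' : A z' ∈ U)
    {η : EuclideanSpace ℝ (Fin m)} (hη : η ∈ projSet D (A z)) {L : ℝ} (hL : 0 < L)
    (hLmax : L ≤ Lmax)
    (hstep : z' ∈ projSet C (z - L⁻¹ • ContinuousLinearMap.adjoint A (A z - η))) :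
    ∃ w ∈ regSubdiff (phiF A D) C z', ‖w‖ ≤ (Lmax + K * ‖A‖ ^ 2) * ‖z' - z‖ := by
  have hgz : g (A z) = A z - η := (hg _ hz).eq_sub_of_mem_projSet hη
  rw [← hgz] at hstep
  refine ⟨_, add_mem_regSubdiff (hasGradientAt_phiF (hg _ hz'))
    (smul_mem_regNormalCone hL (mem_regNormalCone_of_mem_projSet hstep)), ?_⟩
  have heq : L • (z - L⁻¹ • ContinuousLinearMap.adjoint A (g (A z)) - z') +
      ContinuousLinearMap.adjoint A (g (A z')) =
      L • (z - z') + ContinuousLinearMap.adjoint A (g (A z') - g (A z)) := by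
    rw [smul_sub, smul_sub, smul_sub, smul_smul, mul_inv_cancel₀ hL.ne', one_smul, map_sub]
    abel
  rw [heq]
  have h1 : ‖L • (z - z')‖ ≤ Lmax * ‖z' - z‖ := by
    rw [norm_smul, Real.norm_of_nonneg hL.le, norm_sub_rev]
    gcongr
  have h2 : ‖g (A z') - g (A z)‖ ≤ K * (‖A‖ * ‖z' - z‖) := by
    refine (hK.norm_sub_le hz' hz).trans ?_
    rw [← map_sub]
    gcongr
    exact A.le_opNorm _
  have h3 : ‖ContinuousLinearMap.adjoint A (g (A z') - g (A z))‖ ≤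
      ‖A‖ * (K * (‖A‖ * ‖z' - z‖)) := by
    refine (ContinuousLinearMap.le_opNorm _ _).trans ?_
    rw [LinearIsometryEquiv.norm_map]
    gcongr
  refine (norm_add_le _ _).trans ?_
  linarith

end PhiF

section Rates

/-- Tangent-line bound for the concave function `u ↦ u ^ q`, `0 ≤ q ≤ 1`. -/
theorem mul_rpow_mul_sub_le_rpow_sub_rpow {u v q : ℝ} (hu : 0 < u) (hv : 0 ≤ v) (hq0 : 0 ≤ q)
    (hq1 : q ≤ 1) : q * (u - v) ≤ u ^ (1 - q) * (u ^ q - v ^ q) := by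
  have h := rpow_one_add_le_one_add_mul_self (s := v / u - 1)
    (by linarith [div_nonneg hv hu.le]) hq0 hq1
  rw [add_sub_cancel, Real.div_rpow hv hu.le, div_le_iff₀ (by positivity)] at h
  have h1 : u ^ (1 - q) * u ^ q = u := by
    rw [← Real.rpow_add hu]
    simp
  have h2 : u ^ (1 - q) * v ^ q ≤ u ^ (1 - q) * ((1 + q * (v / u - 1)) * u ^ q) := by gcongr
  have h3 : u ^ (1 - q) * ((1 + q * (v / u - 1)) * u ^ q) = u + q * (v - u) := by
    calc _ = (1 + q * (v / u - 1)) * (u ^ (1 - q) * u ^ q) := by ring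
      _ = _ := by rw [h1]; field_simp
  rw [mul_sub (u ^ (1 - q)), h1]
  linarith

/-- Convergence of a descent sequence under a Kurdyka-Łojasiewicz inequality near a cluster point:
the remaining length is controlled by a potential. -/
theorem exists_potential_of_klInequality {E : Type*} [NormedAddCommGroup E] {x : ℕ → E} {x' : E}
    {r : ℕ → ℝ} {θ a c₀ M ρ s : ℝ} (hθ0 : 0 ≤ θ) (hθ1 : θ < 1) (ha : 0 < a) (hc₀ : 0 < c₀)
    (hM : 0 < M) (hρ : 0 < ρ) (hs : 0 < s) (hr : ∀ t, 0 < r t) (hr0 : Tendsto r atTop (𝓝 0))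
    (hstep0 : Tendsto (fun t => ‖x (t + 1) - x t‖) atTop (𝓝 0))
    (hdesc : ∀ t, a * ‖x (t + 1) - x t‖ ^ 2 ≤ r t - r (t + 1))
    (hacc : ∃ σ : ℕ → ℕ, StrictMono σ ∧ Tendsto (fun t => x (σ t)) atTop (𝓝 x'))
    (hkl : ∀ t, ‖x t - x'‖ < ρ → ‖x (t + 1) - x'‖ < ρ → r (t + 1) < s →
      c₀ * r (t + 1) ^ θ ≤ M * ‖x (t + 1) - x t‖) :
    ∃ κ > (0 : ℝ), ∃ T, ∃ P : ℕ → ℝ,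
      (∀ t, P t = ‖x (t + 1) - x t‖ + κ * r (t + 1) ^ (1 - θ)) ∧
      ∀ t ≥ T, c₀ * r (t + 1) ^ θ ≤ M * ‖x (t + 1) - x t‖ ∧
        ‖x (t + 2) - x (t + 1)‖ ≤ P t - P (t + 1) ∧ ‖x t - x'‖ ≤ 2 * P t := by
  have hq : 0 < 1 - θ := by linarith
  set κ : ℝ := M / (c₀ * ((1 - θ) * a)) with hκ
  have hκ0 : 0 < κ := by positivity
  set P : ℕ → ℝ := fun t => ‖x (t + 1) - x t‖ + κ * r (t + 1) ^ (1 - θ) with hP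
  have hP0 : ∀ t, 0 ≤ P t := fun t => by
    have := hr (t + 1)
    positivity
  have hPlim : Tendsto P atTop (𝓝 0) := by
    have h1 : Tendsto (fun t => r (t + 1) ^ (1 - θ)) atTop (𝓝 0) := by
      have h := ((tendsto_add_atTop_iff_nat 1).2 hr0).rpow_const (p := 1 - θ) (Or.inr hq.le)
      rwa [Real.zero_rpow hq.ne'] at h
    simpa using hstep0.add (h1.const_mul κ)
  have hone : ∀ t, c₀ * r (t + 1) ^ θ ≤ M * ‖x (t + 1) - x t‖ →
      ‖x (t + 2) - x (t + 1)‖ ≤ P t - P (t + 1) := by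
    intro t ht
    have h1 := mul_rpow_mul_sub_le_rpow_sub_rpow (hr (t + 1)) (hr (t + 2)).le hq.le
      (by linarith)
    rw [sub_sub_cancel] at h1
    have h2 := hdesc (t + 1)
    set d := ‖x (t + 1) - x t‖ with hd
    have hd0 : 0 ≤ d := norm_nonneg _
    have he0 : 0 ≤ ‖x (t + 2) - x (t + 1)‖ := norm_nonneg _
    set e := ‖x (t + 2) - x (t + 1)‖ with he
    set w := r (t + 1) ^ (1 - θ) - r (t + 2) ^ (1 - θ) with hw
    have h2' : a * e ^ 2 ≤ r (t + 1) - r (t + 2) := h2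
    have hw0 : 0 ≤ w := by
      have : r (t + 2) ≤ r (t + 1) := by nlinarith [sq_nonneg e]
      exact sub_nonneg.2 (Real.rpow_le_rpow (hr _).le this hq.le)
    have h3 : e ^ 2 ≤ d * (κ * w) := by
      have h4 : c₀ * ((1 - θ) * a) * e ^ 2 ≤ M * d * w := by
        calc c₀ * ((1 - θ) * a) * e ^ 2 = c₀ * ((1 - θ) * (a * e ^ 2)) := by ring
          _ ≤ c₀ * ((1 - θ) * (r (t + 1) - r (t + 2))) := by gcongr
          _ ≤ c₀ * (r (t + 1) ^ θ * w) := by gcongr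
          _ = c₀ * r (t + 1) ^ θ * w := by ring
          _ ≤ M * d * w := by gcongr
      calc e ^ 2 = c₀ * ((1 - θ) * a) * e ^ 2 / (c₀ * ((1 - θ) * a)) := by field_simp
        _ ≤ M * d * w / (c₀ * ((1 - θ) * a)) := by gcongr
        _ = d * (κ * w) := by rw [hκ]; ring
    have hκw : 0 ≤ κ * w := by positivity
    have h5 : 2 * e ≤ d + κ * w := by
      refine le_of_sq_le_sq ?_ (by positivity)
      nlinarith [sq_nonneg (d - κ * w)]
    have h6 : P t - P (t + 1) = d + κ * w - e := by
      simp only [hP, hw, hd, he]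
      ring
    linarith
  obtain ⟨σ, hσ, hlim⟩ := hacc
  have hlim1 : Tendsto (fun t => ‖x (σ t) - x'‖) atTop (𝓝 0) :=
    tendsto_iff_norm_sub_tendsto_zero.1 hlim
  have hev := ((hlim1.eventually_lt_const (half_pos (half_pos hρ))).and
    ((hσ.tendsto_atTop.eventually (hPlim.eventually_lt_const (half_pos (half_pos hρ)))).and
      (hσ.tendsto_atTop.eventually (eventually_forall_ge_atTop.2
        ((tendsto_add_atTop_iff_nat 1).2 hr0 |>.eventually_lt_const hs)))))
  obtain ⟨k, hk1, hk2, hk3⟩ := hev.exists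
  set T := σ k with hT
  have hstepP : ∀ t, ‖x (t + 1) - x t‖ ≤ P t := fun t => by
    have := hr (t + 1)
    exact le_add_of_nonneg_right (by positivity)
  have hball1 : ‖x (T + 1) - x'‖ < ρ / 2 := by
    calc ‖x (T + 1) - x'‖ ≤ ‖x (T + 1) - x T‖ + ‖x T - x'‖ := norm_sub_le_norm_sub_add_norm_sub _ _ _
      _ < ρ / 2 := by linarith [hstepP T]
  have htrap : ∀ t ≥ T, ‖x t - x'‖ < ρ ∧ ‖x (t + 1) - x'‖ < ρ ∧
      ‖x (t + 1) - x (T + 1)‖ ≤ P T - P t := by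
    intro t ht
    induction t, ht using Nat.le_induction with
    | base => exact ⟨by linarith, by linarith, by simp⟩
    | succ t ht ih =>
      obtain ⟨i1, i2, i3⟩ := ih
      have h1 := hone t (hkl t i1 i2 (hk3 t ht))
      have h2 : ‖x (t + 2) - x (T + 1)‖ ≤ P T - P (t + 1) :=
        (norm_sub_le_norm_sub_add_norm_sub _ (x (t + 1)) _).trans (by linarith)
      refine ⟨i2, ?_, h2⟩
      have h3 := norm_sub_le_norm_sub_add_norm_sub (x (t + 2)) (x (T + 1)) x'
      have := hP0 (t + 1)
      exact h3.trans_lt (by linarith)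
  have hkl' : ∀ t ≥ T, c₀ * r (t + 1) ^ θ ≤ M * ‖x (t + 1) - x t‖ := fun t ht =>
    hkl t (htrap t ht).1 (htrap t ht).2.1 (hk3 t ht)
  refine ⟨κ, hκ0, T, P, fun _ => rfl, fun t ht => ⟨hkl' t ht, hone t (hkl' t ht), ?_⟩⟩
  have htail : ∀ l ≥ t, ‖x (l + 1) - x (t + 1)‖ ≤ P t - P l := by
    intro l hl
    induction l, hl using Nat.le_induction with
    | base => simp
    | succ l hl ih =>
      have h1 := hone l (hkl' l (ht.trans hl))
      exact (norm_sub_le_norm_sub_add_norm_sub _ (x (l + 1)) _).trans (by linarith)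
  have hlim' : Tendsto (fun j => ‖x (σ j) - x (t + 1)‖) atTop (𝓝 ‖x' - x (t + 1)‖) :=
    (hlim.sub_const _).norm
  have h1 : ‖x' - x (t + 1)‖ ≤ P t := by
    refine le_of_tendsto hlim' ?_
    filter_upwards [hσ.tendsto_atTop.eventually_ge_atTop (t + 1)] with j hj
    obtain ⟨l, hl⟩ : ∃ l, σ j = l + 1 := ⟨σ j - 1, by omega⟩
    rw [hl]
    linarith [htail l (by omega), hP0 l]
  have h2 := norm_sub_le_norm_sub_add_norm_sub (x t) (x (t + 1)) x'
  rw [norm_sub_rev (x t) (x (t + 1)), norm_sub_rev (x (t + 1)) x'] at h2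
  linarith [hstepP t]

theorem exists_le_mul_pow_of_le_mul {u : ℕ → ℝ} {q : ℝ} {T : ℕ} (hq : 0 < q)
    (hu : ∀ t ≥ T, u (t + 1) ≤ q * u t) : ∃ d > (0 : ℝ), ∀ t ≥ T, u t ≤ d * q ^ t := by
  refine ⟨max 1 (u T / q ^ T), by positivity, fun t ht => ?_⟩
  induction t, ht using Nat.le_induction with
  | base =>
    calc u T = u T / q ^ T * q ^ T := by field_simp
      _ ≤ _ := by gcongr; exact le_max_right _ _
  | succ t ht ih =>
    calc u (t + 1) ≤ q * u t := hu t ht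
      _ ≤ q * (max 1 (u T / q ^ T) * q ^ t) := by gcongr
      _ = _ := by ring

theorem one_add_rpow_le_of_le_one {p s : ℝ} (hp : 0 ≤ p) (hs0 : 0 ≤ s) (hs1 : s ≤ 1) :
    (1 + s) ^ p ≤ 1 + p * Real.exp p * s := by
  have h1 : (1 + s) ^ p ≤ Real.exp (p * s) := by
    rw [mul_comm, Real.exp_mul]
    exact Real.rpow_le_rpow (by linarith) (by linarith [Real.add_one_le_exp s]) hp
  have h2 : Real.exp (p * s) ≤ 1 + p * s * Real.exp (p * s) := by
    have h := mul_le_mul_of_nonneg_left (Real.add_one_le_exp (-(p * s)))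
      (Real.exp_pos (p * s)).le
    rw [← Real.exp_add, add_neg_cancel, Real.exp_zero] at h
    linarith
  have h3 : Real.exp (p * s) ≤ Real.exp p := Real.exp_le_exp.2 (by nlinarith)
  have h4 : p * s * Real.exp (p * s) ≤ p * s * Real.exp p := by gcongr
  linarith

/-- A nonnegative sequence with `a * u (t + 1) ^ (1 + 1 / p) ≤ u t - u (t + 1)` decays like
`t ^ (-p)`. -/
theorem exists_le_mul_rpow_of_mul_rpow_le_sub {u : ℕ → ℝ} {a p : ℝ} {T : ℕ} (ha : 0 < a)
    (hp : 0 < p) (hT : 1 ≤ T)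
    (hu : ∀ t ≥ T, a * u (t + 1) ^ (1 + 1 / p) ≤ u t - u (t + 1)) :
    ∃ d > (0 : ℝ), ∀ t ≥ T, u t ≤ d * (t : ℝ) ^ (-p) := by
  set B := 2 * (p * Real.exp p) / a with hB
  have hB0 : 0 < B := by positivity
  have hTpos : (0 : ℝ) < T := by exact_mod_cast hT
  set d := max (B ^ p) (u T * (T : ℝ) ^ p) with hd
  have hd0 : 0 < d := lt_max_of_lt_left (by positivity)
  have hdB : 2 * (p * Real.exp p) ≤ a * d ^ (1 / p) := by
    have h : B ≤ d ^ (1 / p) := by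
      calc B = (B ^ p) ^ (1 / p) := by
            rw [← Real.rpow_mul hB0.le, mul_one_div_cancel hp.ne', Real.rpow_one]
        _ ≤ d ^ (1 / p) := by gcongr; exact le_max_left _ _
    calc 2 * (p * Real.exp p) = a * B := by rw [hB]; field_simp
      _ ≤ _ := by gcongr
  refine ⟨d, hd0, fun t ht => ?_⟩
  induction t, ht using Nat.le_induction with
  | base =>
    rw [Real.rpow_neg hTpos.le, ← div_eq_mul_inv, le_div_iff₀ (by positivity)]
    exact le_max_right _ _
  | succ t ht ih =>
    by_contra! hlt
    have ht1 : (1 : ℝ) ≤ t := by exact_mod_cast hT.trans ht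
    have ht0 : (0 : ℝ) < t := by linarith
    push_cast at hlt
    set v := d * ((t : ℝ) + 1) ^ (-p) with hv
    have hv0 : 0 < v := by positivity
    have h1 : v ^ (1 + 1 / p) = v * (d ^ (1 / p) / (t + 1)) := by
      rw [Real.rpow_add hv0, Real.rpow_one, hv, Real.mul_rpow hd0.le (by positivity),
        ← Real.rpow_mul (by positivity), neg_mul, mul_one_div_cancel hp.ne', Real.rpow_neg_one,
        div_eq_mul_inv (d ^ _)]
    have h2 : v ^ (1 + 1 / p) ≤ u (t + 1) ^ (1 + 1 / p) := by gcongr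
    have h3 : v * (1 + a * d ^ (1 / p) / (t + 1)) < u t := by
      have h4 := hu t ht
      have h5 : a * v ^ (1 + 1 / p) ≤ a * u (t + 1) ^ (1 + 1 / p) := by gcongr
      rw [h1] at h5
      have h6 : v * (1 + a * d ^ (1 / p) / (t + 1)) =
        v + a * (v * (d ^ (1 / p) / (t + 1))) := by ring
      linarith
    have h4 : d * (t : ℝ) ^ (-p) = v * (1 + 1 / (t : ℝ)) ^ p := by
      have h5 : 1 + 1 / (t : ℝ) = (t + 1) / t := by field_simp
      rw [h5, Real.div_rpow (by positivity) ht0.le, hv, Real.rpow_neg ht0.le,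
        Real.rpow_neg (by positivity)]
      have : 0 < (t : ℝ) ^ p := by positivity
      have : 0 < ((t : ℝ) + 1) ^ p := by positivity
      field_simp
    have h5 := one_add_rpow_le_of_le_one hp.le (s := 1 / (t : ℝ)) (by positivity)
      (by rw [div_le_one ht0]; exact ht1)
    have h6 : p * Real.exp p * (1 / t) ≤ a * d ^ (1 / p) / (t + 1) := by
      calc p * Real.exp p * (1 / t) ≤ 2 * (p * Real.exp p) / (t + 1) := by
            rw [mul_one_div, div_le_div_iff₀ ht0 (by positivity)]
            have : 0 < p * Real.exp p := by positivity
            nlinarith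
        _ ≤ _ := by gcongr
    have h7 : v * (1 + 1 / (t : ℝ)) ^ p ≤ v * (1 + a * d ^ (1 / p) / (t + 1)) := by
      gcongr
      linarith
    linarith

/-- A Kurdyka-Łojasiewicz inequality with nonzero exponent bounds the desingularized gap by a power
of the step. -/
theorem rpow_one_sub_le_of_mul_rpow_le {r δ θ c₀ M : ℝ} (hr : 0 < r) (hc₀ : 0 < c₀) (hM : 0 < M)
    (hδ : 0 ≤ δ) (hθ0 : 0 < θ) (hθ1 : θ < 1) (h : c₀ * r ^ θ ≤ M * δ) :
    r ^ (1 - θ) ≤ (M / c₀) ^ ((1 - θ) / θ) * δ ^ ((1 - θ) / θ) := by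
  have hq : 0 < 1 - θ := by linarith
  rw [← Real.mul_rpow (by positivity) hδ]
  calc r ^ (1 - θ) = (r ^ θ) ^ ((1 - θ) / θ) := by
        rw [← Real.rpow_mul hr.le, mul_div_cancel₀ _ hθ0.ne']
    _ ≤ _ := by
        gcongr
        rw [div_mul_eq_mul_div, le_div_iff₀ hc₀]
        linarith

/-- Convergence rates of a descent sequence under a Kurdyka-Łojasiewicz inequality. -/
theorem rates_of_klInequality {E : Type*} [NormedAddCommGroup E] {x : ℕ → E} {x' : E}
    {r : ℕ → ℝ} {θ a c₀ M ρ s : ℝ} (hθ0 : 0 ≤ θ) (hθ1 : θ < 1) (ha : 0 < a) (hc₀ : 0 < c₀)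
    (hM : 0 < M) (hρ : 0 < ρ) (hs : 0 < s) (hr : ∀ t, 0 < r t) (hr0 : Tendsto r atTop (𝓝 0))
    (hstep0 : Tendsto (fun t => ‖x (t + 1) - x t‖) atTop (𝓝 0))
    (hdesc : ∀ t, a * ‖x (t + 1) - x t‖ ^ 2 ≤ r t - r (t + 1))
    (hacc : ∃ σ : ℕ → ℕ, StrictMono σ ∧ Tendsto (fun t => x (σ t)) atTop (𝓝 x'))
    (hkl : ∀ t, ‖x t - x'‖ < ρ → ‖x (t + 1) - x'‖ < ρ → r (t + 1) < s →
      c₀ * r (t + 1) ^ θ ≤ M * ‖x (t + 1) - x t‖) :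
    θ ≠ 0 ∧
    (θ ≤ 1 / 2 → ∃ T : ℕ, ∃ d > (0 : ℝ), ∃ q : ℝ, 0 < q ∧ q < 1 ∧
      ∀ t ≥ T, ‖x t - x'‖ ≤ d * q ^ t) ∧
    (1 / 2 < θ → ∃ T : ℕ, ∃ d > (0 : ℝ),
      ∀ t ≥ T, ‖x t - x'‖ ≤ d * (t : ℝ) ^ (-(1 - θ) / (2 * θ - 1))) := by
  obtain ⟨κ, hκ, T₀, P, hPdef, hPT⟩ := exists_potential_of_klInequality hθ0 hθ1 ha hc₀ hM hρ hs hr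
    hr0 hstep0 hdesc hacc hkl
  have hq : 0 < 1 - θ := by linarith
  obtain ⟨T₁, hT₁⟩ := eventually_atTop.1 (hstep0.eventually_le_const one_pos)
  set T := max T₀ (max T₁ 1) with hT
  have hθne : θ ≠ 0 := by
    rintro rfl
    obtain ⟨T₂, hT₂⟩ := eventually_atTop.1
      (hstep0.eventually_lt_const (show 0 < c₀ / M by positivity))
    have h1 := (hPT (max T₀ T₂) (le_max_left _ _)).1
    have h2 := hT₂ (max T₀ T₂) (le_max_right _ _)
    rw [lt_div_iff₀ hM] at h2
    rw [Real.rpow_zero] at h1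
    linarith
  have hθpos : 0 < θ := lt_of_le_of_ne hθ0 (Ne.symm hθne)
  set α := (1 - θ) / θ with hα
  have hα0 : 0 < α := by positivity
  set B := κ * (M / c₀) ^ α with hB
  have hB0 : 0 < B := by positivity
  have hbound : ∀ t ≥ T, P (t + 1) ≤ ‖x (t + 2) - x (t + 1)‖ +
      B * ‖x (t + 2) - x (t + 1)‖ ^ α := by
    intro t ht
    have h := rpow_one_sub_le_of_mul_rpow_le (hr (t + 2)) hc₀ hM (norm_nonneg _) hθpos hθ1
      (hPT (t + 1) (by omega)).1
    rw [hPdef, hB, mul_assoc]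
    gcongr
  have hle1 : ∀ t ≥ T, ‖x (t + 2) - x (t + 1)‖ ≤ 1 := fun t ht => hT₁ (t + 1) (by omega)
  have hTT₀ : T₀ ≤ T := le_max_left _ _
  refine ⟨hθne, fun hθ2 => ?_, fun hθ2 => ?_⟩
  · have hα1 : 1 ≤ α := by
      rw [hα, one_le_div hθpos]
      linarith
    have hrec : ∀ t ≥ T, P (t + 1) ≤ (1 + B) / (2 + B) * P t := by
      intro t ht
      have h1 := hbound t ht
      have h2 := (hPT t (hTT₀.trans ht)).2.1
      have h3 := Real.rpow_le_rpow_of_exponent_ge_of_imp (norm_nonneg _) (hle1 t ht) hα1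
        (fun _ h => absurd h hα0.ne')
      rw [Real.rpow_one] at h3
      have h4 : B * ‖x (t + 2) - x (t + 1)‖ ^ α ≤ B * ‖x (t + 2) - x (t + 1)‖ := by gcongr
      have h5 : (1 + B) * ‖x (t + 2) - x (t + 1)‖ ≤ (1 + B) * (P t - P (t + 1)) := by gcongr
      rw [div_mul_eq_mul_div, le_div_iff₀ (by positivity)]
      linarith
    obtain ⟨d, hd, hdP⟩ := exists_le_mul_pow_of_le_mul (by positivity) hrec
    refine ⟨T, 2 * d, by positivity, (1 + B) / (2 + B), by positivity, ?_, fun t ht => ?_⟩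
    · rw [div_lt_one (by positivity)]
      linarith
    · linarith [(hPT t (hTT₀.trans ht)).2.2, hdP t ht]
  · have hα1 : α ≤ 1 := by
      rw [hα, div_le_one hθpos]
      linarith
    have h2θ : 0 < 2 * θ - 1 := by linarith
    set p := (1 - θ) / (2 * θ - 1) with hp
    have hp0 : 0 < p := by positivity
    have hβ : 1 + 1 / p = 1 / α := by
      rw [hp, hα]
      field_simp
      ring
    have hrec : ∀ t ≥ T, (1 / (1 + B) ^ (1 / α)) * P (t + 1) ^ (1 + 1 / p) ≤ P t - P (t + 1) := by
      intro t ht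
      have h1 := hbound t ht
      have h2 := (hPT t (hTT₀.trans ht)).2.1
      set e := ‖x (t + 2) - x (t + 1)‖ with he
      have he0 : 0 ≤ e := norm_nonneg _
      have h3 := Real.rpow_le_rpow_of_exponent_ge_of_imp he0 (hle1 t ht) hα1
        (fun _ h => absurd h one_ne_zero)
      rw [Real.rpow_one] at h3
      have h4 : P (t + 1) ≤ (1 + B) * e ^ α := by linarith
      have hP0 : 0 ≤ P (t + 1) := by
        have := hr (t + 2)
        rw [hPdef]
        positivity
      rw [hβ]
      have h5 : P (t + 1) ^ (1 / α) ≤ (1 + B) ^ (1 / α) * e := by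
        calc P (t + 1) ^ (1 / α) ≤ ((1 + B) * e ^ α) ^ (1 / α) := by gcongr
          _ = _ := by
            rw [Real.mul_rpow (by positivity) (by positivity), ← Real.rpow_mul he0,
              mul_one_div_cancel hα0.ne', Real.rpow_one]
      rw [one_div_mul_eq_div, div_le_iff₀ (by positivity)]
      calc _ ≤ (1 + B) ^ (1 / α) * e := h5
        _ ≤ (1 + B) ^ (1 / α) * (P t - P (t + 1)) := by gcongr
        _ = _ := by ring
    obtain ⟨d, hd, hdP⟩ := exists_le_mul_rpow_of_mul_rpow_le_sub (by positivity) hp0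
      (by omega) hrec
    refine ⟨T, 2 * d, by positivity, fun t ht => ?_⟩
    rw [neg_div]
    linarith [(hPT t (hTT₀.trans ht)).2.2, hdP t ht]

end Rates

/-- Local convergence rates of `SpFeas_DC_ls` with `M = 0` under the KL
property of `F` with exponent `θ ∈ [0, 1)`: finite convergence for `θ = 0`, linear rate for
`θ ∈ (0, ½]`, and sublinear rate `t^{−(1−θ)/(2θ−1)}` for `θ ∈ (½, 1)`. -/
theorem stmt_11 (n m : ℕ)
    (A : EuclideanSpace ℝ (Fin n) →L[ℝ] EuclideanSpace ℝ (Fin m))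
    (C : Set (EuclideanSpace ℝ (Fin n))) (D : Set (EuclideanSpace ℝ (Fin m)))
    (hCne : C.Nonempty) (hCcl : IsClosed C) (hDne : D.Nonempty) (hDcl : IsClosed D)
    (hhor : ∀ z, z ∈ horizonCone C → A z ∈ horizonCone D → z = 0)
    (θ : ℝ) (hθ0 : 0 ≤ θ) (hθ1 : θ < 1)
    (hKL : ∀ xb : EuclideanSpace ℝ (Fin n), (limSubdiff (phiF A D) C xb).Nonempty →
      ∃ c₀ > (0 : ℝ), ∃ ε > (0 : ℝ), ∃ s > (0 : ℝ), ∀ z ∈ C, ‖z - xb‖ ≤ ε →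
        0 < phiF A D z - phiF A D xb → phiF A D z - phiF A D xb < s →
        ∀ w ∈ limSubdiff (phiF A D) C z, ‖w‖ ≥ c₀ * (phiF A D z - phiF A D xb) ^ θ)
    (Lmin Lmax c : ℝ) (hLmin : 0 < Lmin) (hLmm : Lmin ≤ Lmax) (hc : 0 < c)
    (x : ℕ → EuclideanSpace ℝ (Fin n)) (hxC : ∀ t, x t ∈ C)
    (hstep : ∀ t : ℕ, ∃ η ∈ projSet D (A (x t)), ∃ Lb : ℝ, Lmin ≤ Lb ∧ Lb ≤ Lmax ∧
      x (t + 1) ∈ projSet C (x t - Lb⁻¹ • ((ContinuousLinearMap.adjoint A) (A (x t) - η))) ∧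
      Metric.infDist (A (x (t + 1))) D ^ 2 ≤
        Metric.infDist (A (x t)) D ^ 2 - c * ‖x (t + 1) - x t‖ ^ 2)
    (xstar : EuclideanSpace ℝ (Fin n))
    (hacc : ∃ σ : ℕ → ℕ, StrictMono σ ∧ Tendsto (fun t => x (σ t)) atTop (𝓝 xstar))
    (hsmooth : ∃ ε > (0 : ℝ), ∃ g : EuclideanSpace ℝ (Fin m) → EuclideanSpace ℝ (Fin m),
      ∃ K : NNReal,
        (∀ y ∈ Metric.ball (A xstar) ε,
          HasGradientAt (fun z => Metric.infDist z D ^ 2 / 2) (g y) y) ∧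
        ContinuousOn g (Metric.ball (A xstar) ε) ∧
        LipschitzOnWith K g (Metric.ball (A xstar) ε)) :
    (θ = 0 → ∃ T : ℕ, ∀ t ≥ T, x t = xstar) ∧
    (0 < θ → θ ≤ 1 / 2 → ∃ T : ℕ, ∃ d > (0 : ℝ), ∃ σr : ℝ, 0 < σr ∧ σr < 1 ∧
      ∀ t ≥ T, ‖x t - xstar‖ ≤ d * σr ^ t) ∧
    (1 / 2 < θ → ∃ T : ℕ, ∃ d > (0 : ℝ),
      ∀ t ≥ T, ‖x t - xstar‖ ≤ d * (t : ℝ) ^ (-(1 - θ) / (2 * θ - 1))) := by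
  obtain ⟨ε₁, hε₁, g, K, hg, -, hK⟩ := hsmooth
  obtain ⟨σ, hσ, hlim⟩ := hacc
  set φ := phiF A D with hφ
  have hφc : Continuous φ := continuous_phiF
  have hdesc : ∀ t, c / 2 * ‖x (t + 1) - x t‖ ^ 2 ≤ φ (x t) - φ (x (t + 1)) := by
    intro t
    obtain ⟨η, -, L, -, -, -, h⟩ := hstep t
    simp only [hφ, phiF]
    linarith
  have hanti : Antitone fun t => φ (x t) := antitone_nat_of_succ_le fun t => by
    have : 0 ≤ c / 2 * ‖x (t + 1) - x t‖ ^ 2 := by positivity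
    linarith [hdesc t]
  have hφlim : Tendsto (fun t => φ (x t)) atTop (𝓝 (φ xstar)) :=
    (tendsto_iff_tendsto_subseq_of_antitone hanti hσ.tendsto_atTop).2 ((hφc.tendsto _).comp hlim)
  have hr0 : Tendsto (fun t => φ (x t) - φ xstar) atTop (𝓝 0) := by
    simpa using hφlim.sub_const (φ xstar)
  have hrnn : ∀ t, 0 ≤ φ (x t) - φ xstar := fun t => sub_nonneg.2 (hanti.le_of_tendsto hφlim t)
  have hstep0 : Tendsto (fun t => ‖x (t + 1) - x t‖) atTop (𝓝 0) := by
    have h1 : Tendsto (fun t => (φ (x t) - φ (x (t + 1))) / (c / 2)) atTop (𝓝 0) := by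
      simpa using (hφlim.sub ((tendsto_add_atTop_iff_nat 1).2 hφlim)).div_const (c / 2)
    have h2 : Tendsto (fun t => ‖x (t + 1) - x t‖ ^ 2) atTop (𝓝 0) := by
      refine squeeze_zero (fun t => by positivity) (fun t => ?_) h1
      rw [le_div_iff₀ (by positivity)]
      linarith [hdesc t]
    simpa using h2.sqrt
  obtain ⟨ρ₁, hρ₁, hball⟩ := Metric.eventually_nhds_iff.1
    (A.continuous.continuousAt.eventually (ball_mem_nhds (A xstar) hε₁) :
      ∀ᶠ z in 𝓝 xstar, A z ∈ ball (A xstar) ε₁)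
  set M := Lmax + K * ‖A‖ ^ 2 with hM
  have hM0 : 0 < M := by
    have : 0 < Lmax := hLmin.trans_le hLmm
    positivity
  have hsub : ∀ t, ‖x t - xstar‖ < ρ₁ → ‖x (t + 1) - xstar‖ < ρ₁ →
      ∃ w ∈ regSubdiff φ C (x (t + 1)), ‖w‖ ≤ M * ‖x (t + 1) - x t‖ := by
    intro t h1 h2
    obtain ⟨η, hη, L, hL1, hL2, hL3, -⟩ := hstep t
    rw [← dist_eq_norm] at h1 h2
    exact exists_mem_regSubdiff_norm_le hg hK (hball h1) (hball h2) hη (hLmin.trans_le hL1) hL2 hL3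
  have hlim1 : Tendsto (fun t => x (σ t + 1)) atTop (𝓝 xstar) := by
    have h1 : Tendsto (fun t => x (σ t + 1) - x (σ t)) atTop (𝓝 0) :=
      tendsto_zero_iff_norm_tendsto_zero.2 (hstep0.comp hσ.tendsto_atTop)
    simpa using h1.add hlim
  have hdom : (limSubdiff φ C xstar).Nonempty := by
    have hev : ∀ᶠ t in atTop, ∃ w ∈ regSubdiff φ C (x (σ t + 1)),
        ‖w‖ ≤ M * ‖x (σ t + 1) - x (σ t)‖ := by
      filter_upwards [(tendsto_iff_norm_sub_tendsto_zero.1 hlim).eventually_lt_const hρ₁,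
        (tendsto_iff_norm_sub_tendsto_zero.1 hlim1).eventually_lt_const hρ₁] with t h1 h2
      exact hsub _ h1 h2
    obtain ⟨N, hN⟩ := eventually_atTop.1 hev
    choose w hw hwle using fun t => hN (t + N) (Nat.le_add_left N t)
    have hshift : Tendsto (fun t => x (σ (t + N) + 1)) atTop (𝓝 xstar) :=
      (tendsto_add_atTop_iff_nat N).2 hlim1
    refine ⟨0, hCcl.mem_of_tendsto hlim (Eventually.of_forall fun t => hxC _), _, w, hw, hshift,
      (hφc.tendsto _).comp hshift, squeeze_zero_norm hwle ?_⟩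
    simpa using (((tendsto_add_atTop_iff_nat N).2
      (hstep0.comp hσ.tendsto_atTop)).const_mul M)
  obtain ⟨c₀, hc₀, ε₂, hε₂, s, hs, hkl⟩ := hKL xstar hdom
  by_cases hpos : ∀ t, 0 < φ (x t) - φ xstar
  · obtain ⟨hne, hlin, hsubl⟩ := rates_of_klInequality (ρ := min ρ₁ ε₂) hθ0 hθ1 (half_pos hc) hc₀
      hM0 (lt_min hρ₁ hε₂) hs hpos hr0 hstep0 (fun t => by linarith [hdesc t]) ⟨σ, hσ, hlim⟩
      (by
        intro t h1 h2 h3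
        obtain ⟨w, hw, hwle⟩ := hsub t (h1.trans_le (min_le_left _ _))
          (h2.trans_le (min_le_left _ _))
        exact (hkl _ (hxC _) (h2.trans_le (min_le_right _ _)).le (hpos _) h3 w
          (regSubdiff_subset_limSubdiff hw)).trans hwle)
    exact ⟨fun h => absurd h hne, fun _ => hlin, hsubl⟩
  · push Not at hpos
    obtain ⟨T, hT⟩ := hpos
    have hconst : ∀ t ≥ T, x t = x T := by
      intro t ht
      induction t, ht using Nat.le_induction with
      | base => rfl
      | succ t ht ih =>
        have h1 : c / 2 * ‖x (t + 1) - x t‖ ^ 2 ≤ 0 := by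
          have := hanti ht
          simp only at this
          linarith [hdesc t, hrnn (t + 1)]
        have h2 : ‖x (t + 1) - x t‖ ^ 2 ≤ 0 := by
          by_contra! h
          have : 0 < c / 2 * ‖x (t + 1) - x t‖ ^ 2 := by positivity
          linarith
        have h3 : x (t + 1) - x t = 0 := by
          simpa using le_antisymm h2 (by positivity)
        rw [sub_eq_zero.1 h3, ih]
    have hxT : x T = xstar := by
      refine tendsto_nhds_unique (tendsto_const_nhds.congr' ?_) hlim
      filter_upwards [hσ.tendsto_atTop.eventually_ge_atTop T] with t ht
      exact (hconst _ ht).symm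
    have heq : ∀ t ≥ T, x t = xstar := fun t ht => (hconst t ht).trans hxT
    refine ⟨fun _ => ⟨T, heq⟩, fun _ _ => ⟨T, 1, one_pos, 1 / 2, by norm_num, by norm_num,
      fun t ht => ?_⟩, fun _ => ⟨T, 1, one_pos, fun t ht => ?_⟩⟩
    · rw [heq t ht, sub_self, norm_zero]
      positivity
    · rw [heq t ht, sub_self, norm_zero]
      positivity
end

section
/- Suppose C ⊆ ℝⁿ and D ⊆ ℝᵐ are both finite unions of nonempty polyhedral sets (each polyhedral set being an intersection of finitely many closed half-spaces {x : ⟨a, x⟩ ≤ b}). Then F is a KL function with exponent ½: for every x̄ ∈ dom ∂F there exist c > 0, ε > 0 and s > 0 such that d(0, ∂F(x)) ≥ c·(F(x) − F(x̄))^{1/2} whenever ‖x − x̄‖ ≤ ε and F(x̄) < F(x) < F(x̄) + s. -/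
open Filter Topology Metric
open scoped RealInnerProductSpace

section PolyhedralErrorBound

variable {E : Type*} [NormedAddCommGroup E] [InnerProductSpace ℝ E]

theorem exists_pos_forall_le {ι : Type*} [Finite ι] (f : ι → ℝ) (hf : ∀ i, 0 < f i) :
    ∃ c > 0, ∀ i, c ≤ f i := by
  rcases isEmpty_or_nonempty ι with h | h
  · exact ⟨1, one_pos, fun i => h.elim i⟩
  · obtain ⟨i, hi⟩ := Finite.exists_min f
    exact ⟨f i, hf i, hi⟩

/-- On the polar of the polyhedral cone `{d | ∀ i ∈ I, ⟪a i, d⟫ ≤ 0}` the norm is controlled by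
the largest violation of the defining inequalities. -/
theorem exists_norm_le_of_mem_polar [FiniteDimensional ℝ E] {ι : Type*} [Fintype ι]
    (a : ι → E) (I : Finset ι) :
    ∃ K > (0 : ℝ), ∀ u : E, (∀ d, (∀ i ∈ I, ⟪a i, d⟫ ≤ 0) → ⟪u, d⟫ ≤ 0) →
      ∀ ρ ≥ (0 : ℝ), (∀ i ∈ I, ⟪a i, u⟫ ≤ ρ) → ‖u‖ ≤ K * ρ := by
  set U : Set E := sphere 0 1 ∩ {u | ∀ d, (∀ i ∈ I, ⟪a i, d⟫ ≤ 0) → ⟪u, d⟫ ≤ 0} with hU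
  have hclosed : IsClosed {u : E | ∀ d, (∀ i ∈ I, ⟪a i, d⟫ ≤ 0) → ⟪u, d⟫ ≤ 0} := by
    simp only [Set.ofPred_forall]
    exact isClosed_iInter fun d => isClosed_iInter fun _ =>
      isClosed_le (by fun_prop) continuous_const
  have hcompact : IsCompact U := (isCompact_sphere 0 1).inter_right hclosed
  set g : E → ℝ := fun u => ∑ i ∈ I, max ⟪a i, u⟫ 0 with hg
  have hgcont : Continuous g := by fun_prop
  have hgpos : ∀ u ∈ U, 0 < g u := by
    intro u hu
    by_contra hcon
    have hzero : ∀ i ∈ I, ⟪a i, u⟫ ≤ 0 := by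
      intro i hi
      have h1 : max ⟪a i, u⟫ 0 ≤ g u :=
        Finset.single_le_sum (f := fun i => max ⟪a i, u⟫ 0) (fun _ _ => le_max_right _ _) hi
      exact (le_max_left _ _).trans (h1.trans (not_lt.1 hcon))
    have h2 := hu.2 u hzero
    have h3 : ‖u‖ = 1 := by simpa using hu.1
    rw [real_inner_self_eq_norm_sq, h3] at h2
    norm_num at h2
  obtain ⟨μ, hμ, hμU⟩ : ∃ μ > 0, ∀ u ∈ U, μ ≤ g u := by
    rcases U.eq_empty_or_nonempty with h | h
    · exact ⟨1, one_pos, by simp [h]⟩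
    · obtain ⟨u, hu, hmin⟩ := hcompact.exists_isMinOn h hgcont.continuousOn
      exact ⟨g u, hgpos u hu, fun w hw => hmin hw⟩
  refine ⟨(I.card + 1) / μ, by positivity, fun u hu ρ hρ hres => ?_⟩
  rcases eq_or_ne u 0 with rfl | hu0
  · rw [norm_zero]; positivity
  have hn : 0 < ‖u‖ := norm_pos_iff.2 hu0
  have hmem : ‖u‖⁻¹ • u ∈ U := by
    refine ⟨by simp [norm_smul, hn.ne'], fun d hd => ?_⟩
    rw [real_inner_smul_left]
    exact mul_nonpos_of_nonneg_of_nonpos (by positivity) (hu d hd)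
  have hle : g (‖u‖⁻¹ • u) ≤ I.card * (‖u‖⁻¹ * ρ) := by
    rw [← nsmul_eq_mul]
    refine Finset.sum_le_card_nsmul _ _ _ fun i hi => max_le ?_ (by positivity)
    rw [real_inner_smul_right]
    exact mul_le_mul_of_nonneg_left (hres i hi) (by positivity)
  have h4 : μ * ‖u‖ ≤ I.card * ρ := by
    have := mul_le_mul_of_nonneg_right ((hμU _ hmem).trans hle) hn.le
    field_simp at this
    linarith
  rw [div_mul_eq_mul_div, le_div_iff₀ hμ]
  linarith

/-- The Hoffman error bound for a nonempty polyhedron. -/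
theorem hoffman_error_bound [FiniteDimensional ℝ E] {ι : Type*} [Fintype ι]
    (a : ι → E) (b : ι → ℝ) (hne : ∃ x, ∀ i, ⟪a i, x⟫ ≤ b i) :
    ∃ K > (0 : ℝ), ∀ x : E, ∀ ρ ≥ (0 : ℝ), (∀ i, ⟪a i, x⟫ ≤ b i + ρ) →
      ∃ p, (∀ i, ⟪a i, p⟫ ≤ b i) ∧ ‖x - p‖ ≤ K * ρ := by
  classical
  choose K hK hKb using exists_norm_le_of_mem_polar a
  obtain ⟨I₀, hI₀⟩ := Finite.exists_max K
  refine ⟨K I₀, hK I₀, fun x ρ hρ hx => ?_⟩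
  set Q : Set E := {z | ∀ i, ⟪a i, z⟫ ≤ b i} with hQ
  have hclosed : IsClosed Q := by
    simp only [hQ, Set.ofPred_forall]
    exact isClosed_iInter fun i => isClosed_le (by fun_prop) continuous_const
  obtain ⟨p, hp, hpx⟩ := hclosed.exists_infDist_eq_dist hne x
  refine ⟨p, hp, ?_⟩
  set I : Finset ι := Finset.univ.filter fun i => ⟪a i, p⟫ = b i with hI
  have hpolar : ∀ d, (∀ i ∈ I, ⟪a i, d⟫ ≤ 0) → ⟪x - p, d⟫ ≤ 0 := by
    intro d hd
    have hev : ∀ᶠ t : ℝ in 𝓝[>] 0, ∀ i, ⟪a i, p + t • d⟫ ≤ b i := by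
      rw [eventually_all]
      intro i
      by_cases hi : ⟪a i, p⟫ = b i
      · filter_upwards [self_mem_nhdsWithin] with t ht
        rw [inner_add_right, real_inner_smul_right, hi]
        have := mul_nonpos_of_nonneg_of_nonpos (le_of_lt (Set.mem_Ioi.1 ht))
          (hd i (by simp [hI, hi]))
        linarith
      · have hlt : ⟪a i, p⟫ < b i := lt_of_le_of_ne (hp i) hi
        have hc : ContinuousAt (fun t : ℝ => ⟪a i, p + t • d⟫) 0 := by fun_prop
        have : ∀ᶠ t : ℝ in 𝓝 0, ⟪a i, p + t • d⟫ < b i :=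
          hc.eventually_lt continuousAt_const (by simpa using hlt)
        filter_upwards [nhdsWithin_le_nhds this] with t ht using ht.le
    have hev2 : ∀ᶠ t : ℝ in 𝓝[>] 0, 2 * ⟪x - p, d⟫ ≤ t * ‖d‖ ^ 2 := by
      filter_upwards [hev, self_mem_nhdsWithin] with t ht ht0
      have ht0 : 0 < t := ht0
      have h1 : dist x p ≤ dist x (p + t • d) := hpx ▸ infDist_le_dist_of_mem ht
      rw [dist_eq_norm, dist_eq_norm, show x - (p + t • d) = (x - p) - t • d by abel] at h1
      have h2 := pow_le_pow_left₀ (norm_nonneg _) h1 2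
      rw [norm_sub_sq_real (x - p), real_inner_smul_right, norm_smul, mul_pow, Real.norm_eq_abs,
        sq_abs] at h2
      have h3 : t * (2 * ⟪x - p, d⟫) ≤ t * (t * ‖d‖ ^ 2) := by linarith
      exact le_of_mul_le_mul_left h3 ht0
    have hlim : Tendsto (fun t : ℝ => t * ‖d‖ ^ 2) (𝓝[>] 0) (𝓝 0) := by
      have : Continuous fun t : ℝ => t * ‖d‖ ^ 2 := by fun_prop
      simpa using (this.tendsto 0).mono_left nhdsWithin_le_nhds
    have := ge_of_tendsto hlim hev2
    linarith
  refine (hKb I (x - p) hpolar ρ hρ fun i hi => ?_).trans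
    (mul_le_mul_of_nonneg_right (hI₀ I) hρ)
  have hi' : ⟪a i, p⟫ = b i := by simpa [hI] using hi
  rw [inner_sub_right, hi']
  linarith [hx i]

theorem IsPolyhedral.isClosed {S : Set E} (hS : IsPolyhedral S) : IsClosed S := by
  obtain ⟨k, a, b, rfl⟩ := hS
  simp only [Set.ofPred_forall]
  exact isClosed_iInter fun i => isClosed_le (by fun_prop) continuous_const

theorem IsPolyhedral.convex {S : Set E} (hS : IsPolyhedral S) : Convex ℝ S := by
  obtain ⟨k, a, b, rfl⟩ := hS
  simp only [Set.ofPred_forall]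
  exact convex_iInter fun i => convex_halfSpace_le (innerₛₗ ℝ (a i)).isLinear (b i)

/-- A linear error bound for the intersection of a polyhedron with a translated linear preimage
of another polyhedron. -/
theorem IsPolyhedral.exists_error_bound [FiniteDimensional ℝ E]
    {F : Type*} [NormedAddCommGroup F] [InnerProductSpace ℝ F] [FiniteDimensional ℝ F]
    (A : E →L[ℝ] F) {S : Set E} {T : Set F} (hS : IsPolyhedral S) (hT : IsPolyhedral T)
    (v : F) (hne : ∃ x ∈ S, A x - v ∈ T) :
    ∃ K > (0 : ℝ), ∀ x ∈ S, ∀ y ∈ T, ∃ p ∈ S, A p - v ∈ T ∧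
      ‖x - p‖ ≤ K * ‖A x - y - v‖ := by
  obtain ⟨k, a, b, rfl⟩ := hS
  obtain ⟨l, e, f, rfl⟩ := hT
  have hadj : ∀ j x, ⟪A.adjoint (e j), x⟫ = ⟪e j, A x⟫ := fun j x =>
    A.adjoint_inner_left x (e j)
  obtain ⟨x₀, hx₀, hx₀'⟩ := hne
  obtain ⟨K, hK, hKb⟩ := hoffman_error_bound
    (Sum.elim a fun j => A.adjoint (e j)) (Sum.elim b fun j => f j + ⟪e j, v⟫) <| by
      refine ⟨x₀, ?_⟩
      rintro (i | j)
      · exact hx₀ i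
      · have := hx₀' j
        rw [inner_sub_right] at this
        simp only [Sum.elim_inr, hadj]
        linarith
  set M : ℝ := ∑ j, ‖e j‖ + 1 with hM
  have hMpos : 0 < M := by positivity
  refine ⟨K * M, by positivity, fun x hx y hy => ?_⟩
  obtain ⟨p, hp, hxp⟩ := hKb x (M * ‖A x - y - v‖) (by positivity) <| by
    rintro (i | j)
    · have := hx i
      have h0 : 0 ≤ M * ‖A x - y - v‖ := by positivity
      simp only [Sum.elim_inl]
      linarith
    · simp only [Sum.elim_inr, hadj]
      have h1 := hy j
      have h2 : ⟪e j, A x - y - v⟫ ≤ M * ‖A x - y - v‖ := by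
        refine (real_inner_le_norm _ _).trans (mul_le_mul_of_nonneg_right ?_ (norm_nonneg _))
        have := Finset.single_le_sum (f := fun j => ‖e j‖) (fun _ _ => norm_nonneg _)
          (Finset.mem_univ j)
        linarith
      rw [inner_sub_right, inner_sub_right] at h2
      linarith
  refine ⟨p, fun i => hp (Sum.inl i), fun j => ?_, by rwa [mul_assoc]⟩
  have := hp (Sum.inr j)
  simp only [Sum.elim_inr, hadj] at this
  rw [inner_sub_right]
  linarith

end PolyhedralErrorBound

/-- If `v` has minimal norm on the segment from `v` to `r`, the squared norm grows at least
quadratically from `v` to `r`. -/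
theorem norm_sq_add_norm_sub_sq_le {F : Type*} [NormedAddCommGroup F] [InnerProductSpace ℝ F]
    {v r : F} (h : ∀ t : ℝ, 0 < t → t ≤ 1 → ‖v‖ ≤ ‖v + t • (r - v)‖) :
    ‖v‖ ^ 2 + ‖r - v‖ ^ 2 ≤ ‖r‖ ^ 2 := by
  have hinner : 0 ≤ ⟪v, r - v⟫ := by
    have hev : ∀ᶠ t : ℝ in 𝓝[>] 0, 0 ≤ 2 * ⟪v, r - v⟫ + t * ‖r - v‖ ^ 2 := by
      filter_upwards [Ioc_mem_nhdsGT (zero_lt_one' ℝ)] with t ht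
      have h2 := pow_le_pow_left₀ (norm_nonneg _) (h t ht.1 ht.2) 2
      rw [norm_add_sq_real, real_inner_smul_right, norm_smul, mul_pow, Real.norm_eq_abs,
        sq_abs] at h2
      have h3 : t * 0 ≤ t * (2 * ⟪v, r - v⟫ + t * ‖r - v‖ ^ 2) := by linarith
      exact le_of_mul_le_mul_left h3 ht.1
    have hlim : Tendsto (fun t : ℝ => 2 * ⟪v, r - v⟫ + t * ‖r - v‖ ^ 2) (𝓝[>] 0)
        (𝓝 (2 * ⟪v, r - v⟫)) := by
      have : Continuous fun t : ℝ => 2 * ⟪v, r - v⟫ + t * ‖r - v‖ ^ 2 := by fun_prop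
      simpa using (this.tendsto 0).mono_left nhdsWithin_le_nhds
    have := ge_of_tendsto hlim hev
    linarith
  have h4 := norm_add_sq_real v (r - v)
  rw [add_sub_cancel] at h4
  linarith

section SplitFeasibility

variable {n m : ℕ} {A : EuclideanSpace ℝ (Fin n) →L[ℝ] EuclideanSpace ℝ (Fin m)}
  {C : Set (EuclideanSpace ℝ (Fin n))} {D : Set (EuclideanSpace ℝ (Fin m))}
  {P : Set (EuclideanSpace ℝ (Fin n))} {Q : Set (EuclideanSpace ℝ (Fin m))}

/-- A regular subgradient of `F` at `x` is a global subgradient of every convex piece of `F`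
that is active at `x`. -/
theorem add_inner_le_of_mem_regSubdiff (hPC : P ⊆ C) (hQD : Q ⊆ D) (hP : Convex ℝ P)
    (hQ : Convex ℝ Q) {x w : EuclideanSpace ℝ (Fin n)} {y : EuclideanSpace ℝ (Fin m)}
    (hx : x ∈ P) (hy : y ∈ Q) (hxy : ‖A x - y‖ = infDist (A x) D)
    (hw : w ∈ regSubdiff (phiF A D) C x) {u : EuclideanSpace ℝ (Fin n)}
    {y' : EuclideanSpace ℝ (Fin m)} (hu : u ∈ P) (hy' : y' ∈ Q) :
    phiF A D x + ⟪w, u - x⟫ ≤ ‖A u - y'‖ ^ 2 / 2 := by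
  suffices h : ∀ ε > 0, phiF A D x + ⟪w, u - x⟫ - ε * ‖u - x‖ ≤ ‖A u - y'‖ ^ 2 / 2 by
    have hlim : Tendsto (fun ε : ℝ => phiF A D x + ⟪w, u - x⟫ - ε * ‖u - x‖) (𝓝[>] 0)
        (𝓝 (phiF A D x + ⟪w, u - x⟫)) := by
      have : Continuous fun ε : ℝ => phiF A D x + ⟪w, u - x⟫ - ε * ‖u - x‖ := by fun_prop
      simpa using (this.tendsto 0).mono_left nhdsWithin_le_nhds
    exact le_of_tendsto hlim (eventually_mem_nhdsWithin.mono h)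
  intro ε hε
  obtain ⟨δ, hδ, hreg⟩ := hw.2 ε hε
  have hcont : ContinuousAt (fun t : ℝ => ‖t • (u - x)‖) 0 := by fun_prop
  have hsmall : ∀ᶠ t : ℝ in 𝓝[>] 0, ‖t • (u - x)‖ < δ :=
    nhdsWithin_le_nhds (hcont.eventually_lt continuousAt_const (by simpa using hδ))
  obtain ⟨t, htδ, ht0, ht1⟩ := (hsmall.and (Ioc_mem_nhdsGT (zero_lt_one' ℝ))).exists
  have hxt : x + t • (u - x) ∈ P := hP.add_smul_sub_mem hx hu ⟨ht0.le, ht1⟩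
  have hyt : y + t • (y' - y) ∈ Q := hQ.add_smul_sub_mem hy hy' ⟨ht0.le, ht1⟩
  have h1 := hreg _ (hPC hxt) (by simpa using htδ)
  rw [add_sub_cancel_left, real_inner_smul_right, norm_smul, Real.norm_eq_abs,
    abs_of_pos ht0] at h1
  have hφx : phiF A D x = ‖A x - y‖ ^ 2 / 2 := by rw [phiF, hxy]
  have h2 : phiF A D (x + t • (u - x)) ≤
      ‖(1 - t) • (A x - y) + t • (A u - y')‖ ^ 2 / 2 := by
    have h3 := infDist_le_dist_of_mem (x := A (x + t • (u - x))) (hQD hyt)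
    rw [dist_eq_norm] at h3
    have h4 : A (x + t • (u - x)) - (y + t • (y' - y)) =
        (1 - t) • (A x - y) + t • (A u - y') := by
      rw [map_add, map_smul, map_sub]
      module
    rw [h4] at h3
    have := pow_le_pow_left₀ infDist_nonneg h3 2
    rw [phiF]
    linarith
  have h5 : ‖(1 - t) • (A x - y) + t • (A u - y')‖ ^ 2 ≤
      (1 - t) * ‖A x - y‖ ^ 2 + t * ‖A u - y'‖ ^ 2 := by
    have h6 : ‖(1 - t) • (A x - y) + t • (A u - y')‖ ≤
        (1 - t) * ‖A x - y‖ + t * ‖A u - y'‖ := by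
      refine (norm_add_le _ _).trans_eq ?_
      rw [norm_smul, norm_smul, Real.norm_eq_abs, Real.norm_eq_abs, abs_of_pos ht0,
        abs_of_nonneg (sub_nonneg.2 ht1)]
    have h7 := pow_le_pow_left₀ (norm_nonneg _) h6 2
    nlinarith [mul_nonneg (mul_nonneg ht0.le (sub_nonneg.2 ht1))
      (sq_nonneg (‖A x - y‖ - ‖A u - y'‖))]
  have h8 : t * (phiF A D x + ⟪w, u - x⟫ - ε * ‖u - x‖) ≤ t * (‖A u - y'‖ ^ 2 / 2) := by
    rw [hφx] at h1 ⊢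
    linarith
  exact le_of_mul_le_mul_left h8 ht0

/-- The KL inequality at a point that minimizes a convex polyhedral piece of `F`. -/
theorem exists_kl_of_isMin (hPC : P ⊆ C) (hQD : Q ⊆ D) (hP : IsPolyhedral P)
    (hQ : IsPolyhedral Q) {xb : EuclideanSpace ℝ (Fin n)} {yb : EuclideanSpace ℝ (Fin m)}
    (hxb : xb ∈ P) (hyb : yb ∈ Q) (hxyb : ‖A xb - yb‖ = infDist (A xb) D)
    (hmin : ∀ u ∈ P, ∀ y' ∈ Q, ‖A xb - yb‖ ≤ ‖A u - y'‖) :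
    ∃ c > (0 : ℝ), ∀ x ∈ P, ∀ y ∈ Q, ‖A x - y‖ = infDist (A x) D →
      phiF A D xb < phiF A D x → ∀ w ∈ regSubdiff (phiF A D) C x,
        c * √(phiF A D x - phiF A D xb) ≤ ‖w‖ := by
  set v := A xb - yb with hv
  obtain ⟨K, hK, hKb⟩ := hP.exists_error_bound A hQ v ⟨xb, hxb, by simpa [hv] using hyb⟩
  refine ⟨1 / (K * √2), by positivity, fun x hx y hy hxy hlt w hw => ?_⟩
  obtain ⟨p, hp, hpQ, hxp⟩ := hKb x hx y hy
  have hsub := add_inner_le_of_mem_regSubdiff hPC hQD hP.convex hQ.convex hx hy hxy hw hp hpQ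
  rw [sub_sub_cancel] at hsub
  have hφb : phiF A D xb = ‖v‖ ^ 2 / 2 := by rw [phiF, hxyb]
  have hφx : phiF A D x = ‖A x - y‖ ^ 2 / 2 := by rw [phiF, hxy]
  have hgrow : ‖v‖ ^ 2 + ‖A x - y - v‖ ^ 2 ≤ ‖A x - y‖ ^ 2 := by
    refine norm_sq_add_norm_sub_sq_le fun t ht0 ht1 => ?_
    have h1 := hmin _ (hP.convex.add_smul_sub_mem hxb hx ⟨ht0.le, ht1⟩) _
      (hQ.convex.add_smul_sub_mem hyb hy ⟨ht0.le, ht1⟩)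
    have h2 : v + t • (A x - y - v) = A (xb + t • (x - xb)) - (yb + t • (y - yb)) := by
      rw [map_add, map_smul, map_sub, hv]
      module
    rwa [h2]
  set Δ := phiF A D x - phiF A D xb with hΔ
  have hΔpos : 0 < Δ := sub_pos.2 hlt
  have h2 : ‖A x - y - v‖ ≤ √2 * √Δ := by
    rw [← Real.sqrt_mul zero_le_two]
    refine Real.le_sqrt_of_sq_le ?_
    linarith
  have h3 : Δ ≤ ‖w‖ * ‖x - p‖ := by
    have := real_inner_le_norm w (x - p)
    rw [← neg_sub p x, inner_neg_right, norm_neg, norm_sub_rev] at this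
    linarith
  have h4 : √Δ * √Δ ≤ (‖w‖ * (K * √2)) * √Δ := by
    rw [Real.mul_self_sqrt hΔpos.le]
    calc Δ ≤ ‖w‖ * ‖x - p‖ := h3
      _ ≤ ‖w‖ * (K * (√2 * √Δ)) := by gcongr; exact hxp.trans (by gcongr)
      _ = _ := by ring
  have h5 := le_of_mul_le_mul_right h4 (Real.sqrt_pos.2 hΔpos)
  rw [div_mul_eq_mul_div, one_mul, div_le_iff₀ (by positivity)]
  exact h5

/-- The KL inequality for regular subgradients at points where a given polyhedral piece of `F`
is active. -/
theorem exists_kl_of_piece (hPC : P ⊆ C) (hQD : Q ⊆ D) (hP : IsPolyhedral P)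
    (hQ : IsPolyhedral Q) (hQne : Q.Nonempty) (xb : EuclideanSpace ℝ (Fin n)) :
    ∃ c > (0 : ℝ), ∃ ε > (0 : ℝ), ∃ s > (0 : ℝ), ∀ x ∈ P, ∀ y ∈ Q,
      ‖A x - y‖ = infDist (A x) D → ‖x - xb‖ < ε → phiF A D xb < phiF A D x →
      phiF A D x < phiF A D xb + s → ∀ w ∈ regSubdiff (phiF A D) C x,
        c * √(phiF A D x - phiF A D xb) ≤ ‖w‖ := by
  by_cases hxb : xb ∈ P
  swap
  · obtain ⟨ε, hε, hball⟩ := Metric.isOpen_iff.1 hP.isClosed.isOpen_compl xb hxb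
    refine ⟨1, one_pos, ε, hε, 1, one_pos, fun x hx y hy hxy hxε => ?_⟩
    exact absurd hx (hball (by simpa [dist_eq_norm] using hxε))
  by_cases hact : infDist (A xb) Q ≤ infDist (A xb) D
  swap
  · have hlt : phiF A D xb < infDist (A xb) Q ^ 2 / 2 := by
      have := pow_lt_pow_left₀ (not_le.1 hact) infDist_nonneg two_ne_zero
      rw [phiF]
      linarith
    obtain ⟨τ, hτ1, hτ2⟩ := exists_between hlt
    have hc : ContinuousAt (fun x => infDist (A x) Q ^ 2 / 2) xb := by
      have := (continuous_infDist_pt Q).comp A.continuous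
      exact ((this.pow 2).div_const 2).continuousAt
    obtain ⟨ε, hε, hball⟩ := Metric.eventually_nhds_iff.1
      (continuousAt_const.eventually_lt hc hτ2)
    refine ⟨1, one_pos, ε, hε, τ - phiF A D xb, sub_pos.2 hτ1,
      fun x hx y hy hxy hxε _ hs => ?_⟩
    have h1 := hball (by simpa [dist_eq_norm] using hxε)
    have h2 := pow_le_pow_left₀ infDist_nonneg (infDist_le_dist_of_mem (x := A x) hy) 2
    rw [dist_eq_norm, hxy] at h2
    rw [add_sub_cancel, phiF] at hs
    linarith
  obtain ⟨yb, hyb, hdist⟩ := hQ.isClosed.exists_infDist_eq_dist hQne (A xb)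
  have hxyb : ‖A xb - yb‖ = infDist (A xb) D := by
    rw [← dist_eq_norm]
    exact le_antisymm (hdist ▸ hact) (infDist_le_dist_of_mem (hQD hyb))
  by_cases hmin : ∀ u ∈ P, ∀ y' ∈ Q, ‖A xb - yb‖ ≤ ‖A u - y'‖
  · obtain ⟨c, hc, h⟩ := exists_kl_of_isMin hPC hQD hP hQ hxb hyb hxyb hmin
    exact ⟨c, hc, 1, one_pos, 1, one_pos, fun x hx y hy hxy _ hlt _ => h x hx y hy hxy hlt⟩
  push Not at hmin
  obtain ⟨u, hu, y', hy', hlt⟩ := hmin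
  have hδ : 0 < phiF A D xb - ‖A u - y'‖ ^ 2 / 2 := by
    have := pow_lt_pow_left₀ hlt (norm_nonneg _) two_ne_zero
    rw [phiF, ← hxyb]
    linarith
  set δ := phiF A D xb - ‖A u - y'‖ ^ 2 / 2 with hδdef
  refine ⟨δ / (‖u - xb‖ + 1), by positivity, 1, one_pos, 1, one_pos,
    fun x hx y hy hxy hxε hgt hs w hw => ?_⟩
  have h1 := add_inner_le_of_mem_regSubdiff hPC hQD hP.convex hQ.convex hx hy hxy hw hu hy'
  have h2 : δ ≤ ‖w‖ * ‖u - x‖ := by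
    have := real_inner_le_norm w (x - u)
    rw [← neg_sub u x, inner_neg_right, norm_neg] at this
    linarith
  have h3 : ‖u - x‖ ≤ ‖u - xb‖ + 1 := by
    have := norm_sub_le_norm_sub_add_norm_sub u xb x
    rw [norm_sub_rev xb x] at this
    linarith
  have h4 : √(phiF A D x - phiF A D xb) ≤ 1 := Real.sqrt_le_one.2 (by linarith)
  calc δ / (‖u - xb‖ + 1) * √(phiF A D x - phiF A D xb) ≤ δ / (‖u - xb‖ + 1) * 1 := by gcongr
    _ = δ / (‖u - xb‖ + 1) := mul_one _
    _ ≤ ‖w‖ := by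
      rw [div_le_iff₀ (by positivity)]
      exact h2.trans (by gcongr)

end SplitFeasibility

/-- If `C` and `D` are finite unions of nonempty polyhedral sets, then
`F = ½ d(A·, D)² + δ_C` is a KL function with exponent `½`. -/
theorem stmt_16 (n m : ℕ)
    (A : EuclideanSpace ℝ (Fin n) →L[ℝ] EuclideanSpace ℝ (Fin m))
    (C : Set (EuclideanSpace ℝ (Fin n))) (D : Set (EuclideanSpace ℝ (Fin m)))
    (hCne : C.Nonempty) (hCcl : IsClosed C) (hDne : D.Nonempty) (hDcl : IsClosed D)
    (hCpoly : ∃ (k : ℕ) (Ci : Fin k → Set (EuclideanSpace ℝ (Fin n))),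
      (∀ i, IsPolyhedral (Ci i) ∧ (Ci i).Nonempty) ∧ C = ⋃ i, Ci i)
    (hDpoly : ∃ (l : ℕ) (Dj : Fin l → Set (EuclideanSpace ℝ (Fin m))),
      (∀ j, IsPolyhedral (Dj j) ∧ (Dj j).Nonempty) ∧ D = ⋃ j, Dj j) :
    ∀ xb : EuclideanSpace ℝ (Fin n), (limSubdiff (phiF A D) C xb).Nonempty →
      ∃ c > (0 : ℝ), ∃ ε > (0 : ℝ), ∃ s > (0 : ℝ), ∀ z ∈ C, ‖z - xb‖ ≤ ε →
        phiF A D xb < phiF A D z → phiF A D z < phiF A D xb + s →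
        ∀ w ∈ limSubdiff (phiF A D) C z,
          ‖w‖ ≥ c * Real.sqrt (phiF A D z - phiF A D xb) := by
  intro xb _
  obtain ⟨k, Ci, hCi, hCU⟩ := hCpoly
  obtain ⟨l, Dj, hDj, hDU⟩ := hDpoly
  have hCsub : ∀ i, Ci i ⊆ C := fun i => hCU ▸ Set.subset_iUnion Ci i
  have hDsub : ∀ j, Dj j ⊆ D := fun j => hDU ▸ Set.subset_iUnion Dj j
  choose c hc ε hε s hs hkl using fun ij : Fin k × Fin l =>
    exists_kl_of_piece (A := A) (hCsub ij.1) (hDsub ij.2) (hCi ij.1).1 (hDj ij.2).1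
      (hDj ij.2).2 xb
  obtain ⟨c₀, hc₀, hcle⟩ := exists_pos_forall_le c hc
  obtain ⟨ε₀, hε₀, hεle⟩ := exists_pos_forall_le ε hε
  obtain ⟨s₀, hs₀, hsle⟩ := exists_pos_forall_le s hs
  refine ⟨c₀, hc₀, ε₀ / 2, by positivity, s₀, hs₀, fun z _ hzε hz hzs w hw => ?_⟩
  obtain ⟨-, xs, vs, hreg, hxs, hφ, hvs⟩ := hw
  have hsqrt : Tendsto (fun t => c₀ * √(phiF A D (xs t) - phiF A D xb)) atTop
      (𝓝 (c₀ * √(phiF A D z - phiF A D xb))) :=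
    ((Real.continuous_sqrt.tendsto _).comp (hφ.sub_const _)).const_mul _
  refine le_of_tendsto_of_tendsto hsqrt hvs.norm ?_
  have hnear : ∀ᶠ t in atTop, ‖xs t - xb‖ < ε₀ :=
    (hxs.sub_const xb).norm.eventually_lt_const (by linarith)
  filter_upwards [hnear, hφ.eventually_const_lt hz, hφ.eventually_lt_const hzs] with t h1 h2 h3
  obtain ⟨y, hy, hdist⟩ := hDcl.exists_infDist_eq_dist hDne (A (xs t))
  obtain ⟨i, hi⟩ := Set.mem_iUnion.1 (hCU ▸ (hreg t).1)
  obtain ⟨j, hj⟩ := Set.mem_iUnion.1 (hDU ▸ hy)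
  refine le_trans (mul_le_mul_of_nonneg_right (hcle (i, j)) (Real.sqrt_nonneg _))
    (hkl (i, j) (xs t) hi y hj ?_ (h1.trans_le (hεle _)) h2 (h3.trans_le ?_) _ (hreg t))
  · rw [hdist, dist_eq_norm]
  · linarith [hsle (i, j)]
end
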